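/- Let Λ ⊂ ℝ be a separated set and σ ∈ ℝ, and let S = {(n, λ − σn/π) : n ∈ ℤ, λ ∈ Λ} ⊂ ℝ². Then D₂⁻(S) = D⁻(Λ), where D₂⁻(S) = liminf_{r→∞} inf_{z∈ℂ} card(S ∩ B_r(z))/(π r²) is the lower planar Beurling density (B_r(z) being the Euclidean disc of center z and radius r, with ℝ² identified with ℂ), and D⁻(Λ) = lim_{r→∞} inf_{x∈ℝ} card(Λ∩[x,x+r])/r is the lower linear Beurling density. -/

import Mathlib

open MeasureTheory Filter Metric Complex

noncomputable section

/-- A set `Λ ⊆ ℝ` is separated. -/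
def Separated (Λ : Set ℝ) : Prop :=
  ∃ δ : ℝ, 0 < δ ∧ ∀ x ∈ Λ, ∀ y ∈ Λ, x ≠ y → δ ≤ |x - y|

/-- Lower Beurling density. -/
def lowerDensity (Λ : Set ℝ) : ℝ :=
  liminf (fun r : ℝ => ⨅ x : ℝ, ((Λ ∩ Set.Icc x (x + r)).ncard : ℝ) / r) atTop

def upperDensity (Λ : Set ℝ) : ℝ :=
  limsup (fun r : ℝ => ⨆ x : ℝ, ((Λ ∩ Set.Icc x (x + r)).ncard : ℝ) / r) atTop

/-- Gabor coefficient. -/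
def gaborCoef (g f : ℝ → ℂ) (p : ℝ × ℝ) : ℂ :=
  ∫ t : ℝ, f t * (starRingEnd ℂ) (Complex.exp (-2 * Real.pi * Complex.I * p.2 * t) * g (p.1 - t))

def IsGaborFrame (g : ℝ → ℂ) (S : Set (ℝ × ℝ)) : Prop :=
  ∃ A B : ℝ, 0 < A ∧ 0 < B ∧ ∀ f : ℝ → ℂ, MemLp f 2 (volume : Measure ℝ) →
    A * (∫ t : ℝ, ‖f t‖ ^ 2) ≤ (∑' p : S, ‖gaborCoef g f p‖ ^ 2) ∧
    (∑' p : S, ‖gaborCoef g f p‖ ^ 2) ≤ B * (∫ t : ℝ, ‖f t‖ ^ 2)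

/-- membership in shift invariant space -/
def InV2 (g : ℝ → ℂ) (f : ℝ → ℂ) : Prop :=
  ∃ c : ℤ → ℂ, Memℓp c 2 ∧ ∀ x : ℝ, HasSum (fun n : ℤ => c n * g (x - n)) (f x)

def IsSamplingSet (g : ℝ → ℂ) (Λ : Set ℝ) : Prop :=
  ∃ A B : ℝ, 0 < A ∧ 0 < B ∧ ∀ f : ℝ → ℂ, InV2 g f →
    A * (∫ t : ℝ, ‖f t‖ ^ 2) ≤ (∑' l : Λ, ‖f l‖ ^ 2) ∧
    (∑' l : Λ, ‖f l‖ ^ 2) ≤ B * (∫ t : ℝ, ‖f t‖ ^ 2)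

def IsInterpolatingSet (g : ℝ → ℂ) (Λ : Set ℝ) : Prop :=
  ∀ a : Λ → ℂ, Memℓp a 2 → ∃ f : ℝ → ℂ, InV2 g f ∧ ∀ l : Λ, f l = a l

def IsSamplingSeqV (g : ℝ → ℂ) (lam : ℤ → ℝ) : Prop :=
  ∃ A B : ℝ, 0 < A ∧ 0 < B ∧ ∀ f : ℝ → ℂ, InV2 g f →
    A * (∫ t : ℝ, ‖f t‖ ^ 2) ≤ (∑' m : ℤ, ‖f (lam m)‖ ^ 2) ∧
    (∑' m : ℤ, ‖f (lam m)‖ ^ 2) ≤ B * (∫ t : ℝ, ‖f t‖ ^ 2)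

/-- Fock weight function φ. -/
def phiF (β γ : ℝ) (z : ℂ) : ℝ :=
  β * (Real.log (‖z‖)) ^ 2 + γ * Real.log (‖z‖)

def MemFock (β γ : ℝ) (F : ℂ → ℂ) : Prop :=
  DifferentiableOn ℂ F {(0 : ℂ)}ᶜ ∧
    Integrable (fun z : ℂ => ‖F z‖ ^ 2 * Real.exp (-2 * phiF β γ z)) volume

def fockNormSq (β γ : ℝ) (F : ℂ → ℂ) : ℝ :=
  (1 / Real.pi) * ∫ z : ℂ, ‖F z‖ ^ 2 * Real.exp (-2 * phiF β γ z)

def fockWeight (β γ : ℝ) (w : ℂ) : ℝ :=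
  (1 + ‖w‖ ^ 2) * Real.exp (-2 * phiF β γ w)

def IsFockSamplingSeq (β γ : ℝ) (u : ℤ → ℂ) : Prop :=
  ∃ A B : ℝ, 0 < A ∧ 0 < B ∧ ∀ F : ℂ → ℂ, MemFock β γ F →
    A * fockNormSq β γ F ≤ (∑' m : ℤ, fockWeight β γ (u m) * ‖F (u m)‖ ^ 2) ∧
    (∑' m : ℤ, fockWeight β γ (u m) * ‖F (u m)‖ ^ 2) ≤ B * fockNormSq β γ F

def IsFockInterpolatingSeq (β γ : ℝ) (u : ℤ → ℂ) : Prop :=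
  ∀ a : ℤ → ℂ, Summable (fun m : ℤ => fockWeight β γ (u m) * ‖a m‖ ^ 2) →
    ∃ F : ℂ → ℂ, MemFock β γ F ∧ ∀ m : ℤ, F (u m) = a m

def IsFockSamplingSet (β γ : ℝ) (Λ : Set ℂ) : Prop :=
  ∃ A B : ℝ, 0 < A ∧ 0 < B ∧ ∀ F : ℂ → ℂ, MemFock β γ F →
    A * fockNormSq β γ F ≤ (∑' w : Λ, fockWeight β γ w * ‖F w‖ ^ 2) ∧
    (∑' w : Λ, fockWeight β γ w * ‖F w‖ ^ 2) ≤ B * fockNormSq β γ F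

def IsFockInterpolatingSet (β γ : ℝ) (Λ : Set ℂ) : Prop :=
  ∀ a : Λ → ℂ, Summable (fun w : Λ => fockWeight β γ (w : ℂ) * ‖a w‖ ^ 2) →
    ∃ F : ℂ → ℂ, MemFock β γ F ∧ ∀ w : Λ, F w = a w

/-- the canonical product A(z) -/
def Afun (a b : ℂ) (z : ℂ) : ℂ :=
  ∏' n : ℕ, (1 + z * Complex.exp (-(a + b) * (n + 1)))

def Gfun (a b : ℂ) (z : ℂ) : ℂ := (1 + z) * Afun a b z * Afun a b (1 / z)

/-- the discrete Cauchy transform G(z) Σ c_n e^{an}/(z+e^{(a+b)n}) -/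
def cauchyT (a b : ℂ) (c : ℤ → ℂ) (z : ℂ) : ℂ :=
  Gfun a b z * ∑' n : ℤ, c n * Complex.exp (a * n) / (z + Complex.exp ((a + b) * n))

/-- norm of the evaluation functional at `w` on `H_{a,b}` -/
def Hnorm (a b : ℂ) (w : ℂ) : ℝ :=
  sSup {r : ℝ | ∃ c : ℤ → ℂ, Memℓp c 2 ∧ (∑' n : ℤ, ‖c n‖ ^ 2) ≤ 1 ∧ r = ‖cauchyT a b c w‖}

def IsSamplingSeqH (a b : ℂ) (u : ℤ → ℂ) : Prop :=
  ∃ A B : ℝ, 0 < A ∧ 0 < B ∧ ∀ c : ℤ → ℂ, Memℓp c 2 →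
    A * (∑' n : ℤ, ‖c n‖ ^ 2) ≤ (∑' m : ℤ, ((Hnorm a b (u m)) ^ 2)⁻¹ * ‖cauchyT a b c (u m)‖ ^ 2) ∧
    (∑' m : ℤ, ((Hnorm a b (u m)) ^ 2)⁻¹ * ‖cauchyT a b c (u m)‖ ^ 2) ≤ B * (∑' n : ℤ, ‖c n‖ ^ 2)

lemma Separated.finite_ncard_inter_Icc_le {Λ : Set ℝ} {δ : ℝ} (hδ : 0 < δ)
    (h : ∀ x ∈ Λ, ∀ y ∈ Λ, x ≠ y → δ ≤ |x - y|) (a b : ℝ) (hab : a ≤ b) :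
    (Λ ∩ Set.Icc a b).Finite ∧ ((Λ ∩ Set.Icc a b).ncard : ℝ) ≤ (b - a) / δ + 1 := by
  have hmaps : ∀ l ∈ Λ ∩ Set.Icc a b,
      ⌊(l - a) / δ⌋ ∈ (Finset.Icc 0 ⌊(b - a) / δ⌋ : Finset ℤ) := by
    rintro l ⟨-, hl⟩
    rw [Finset.mem_Icc]
    constructor
    · exact Int.floor_nonneg.2 (div_nonneg (sub_nonneg.2 hl.1) hδ.le)
    · gcongr
      exact hl.2
  have hinj : Set.InjOn (fun l : ℝ => ⌊(l - a) / δ⌋) (Λ ∩ Set.Icc a b) := by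
    intro l hl m hm hlm
    by_contra hne
    have hlt := Int.abs_sub_lt_one_of_floor_eq_floor hlm
    rw [← sub_div, abs_div, abs_of_pos hδ, div_lt_one hδ, sub_sub_sub_cancel_right] at hlt
    exact absurd (h l hl.1 m hm.1 hne) (not_le.2 hlt)
  refine ⟨Set.Finite.of_injOn hmaps hinj (Finset.finite_toSet _), ?_⟩
  have hcard := Set.ncard_le_ncard_of_injOn (t := (Finset.Icc 0 ⌊(b - a) / δ⌋ : Finset ℤ)) _
    hmaps hinj (Finset.finite_toSet _)
  rw [Set.ncard_coe_finset, Int.card_Icc] at hcard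
  have hfl : 0 ≤ ⌊(b - a) / δ⌋ := Int.floor_nonneg.2 (div_nonneg (sub_nonneg.2 hab) hδ.le)
  have hcast : ((⌊(b - a) / δ⌋ + 1 - 0).toNat : ℤ) = ⌊(b - a) / δ⌋ + 1 := by omega
  calc ((Λ ∩ Set.Icc a b).ncard : ℝ) ≤ ((⌊(b - a) / δ⌋ + 1 - 0).toNat : ℝ) := by
        exact_mod_cast hcard
    _ = (⌊(b - a) / δ⌋ : ℝ) + 1 := by exact_mod_cast hcast
    _ ≤ (b - a) / δ + 1 := by gcongr; exact Int.floor_le _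

lemma Separated.finite_inter_Icc {Λ : Set ℝ} (hΛ : Separated Λ) (a b : ℝ) :
    (Λ ∩ Set.Icc a b).Finite := by
  obtain ⟨δ, hδ, h⟩ := hΛ
  rcases le_or_gt a b with hab | hab
  · exact (Separated.finite_ncard_inter_Icc_le hδ h a b hab).1
  · simp [Set.Icc_eq_empty (not_le.2 hab)]

lemma bddBelow_range_ncard_div (Λ : Set ℝ) {r : ℝ} (hr : 0 ≤ r) :
    BddBelow (Set.range fun x : ℝ => ((Λ ∩ Set.Icc x (x + r)).ncard : ℝ) / r) :=
  ⟨0, by rintro _ ⟨x, rfl⟩; positivity⟩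

lemma lowerDensity_le_ncard (Λ : Set ℝ) {ε : ℝ} (hε : 0 < ε) :
    ∃ C : ℝ, 0 ≤ C ∧ ∀ a b : ℝ, a ≤ b →
      (lowerDensity Λ - ε) * (b - a) - C ≤ ((Λ ∩ Set.Icc a b).ncard : ℝ) := by
  have hlt : lowerDensity Λ - ε < lowerDensity Λ := by linarith
  have hbdd : IsBoundedUnder (· ≥ ·) atTop
      (fun r : ℝ => ⨅ x : ℝ, ((Λ ∩ Set.Icc x (x + r)).ncard : ℝ) / r) := by
    refine ⟨0, eventually_map.2 ?_⟩
    filter_upwards [eventually_ge_atTop 0] with r hr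
    exact Real.iInf_nonneg fun x => by positivity
  obtain ⟨R, hR⟩ := eventually_atTop.1 (eventually_lt_of_lt_liminf hlt hbdd)
  refine ⟨|lowerDensity Λ - ε| * max R 1, by positivity, fun a b hab => ?_⟩
  rcases le_or_gt (max R 1) (b - a) with h | h
  · have hpos : 0 < b - a := by linarith [le_max_right R 1]
    have h1 := (hR (b - a) ((le_max_left _ _).trans h)).le.trans
      (ciInf_le (bddBelow_range_ncard_div Λ hpos.le) a)
    rw [le_div_iff₀ hpos, add_sub_cancel] at h1
    have : 0 ≤ |lowerDensity Λ - ε| * max R 1 := by positivity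
    linarith
  · have h1 : (lowerDensity Λ - ε) * (b - a) ≤ |lowerDensity Λ - ε| * max R 1 :=
      mul_le_mul (le_abs_self _) h.le (sub_nonneg.2 hab) (abs_nonneg _)
    have h2 : (0 : ℝ) ≤ ((Λ ∩ Set.Icc a b).ncard : ℝ) := by positivity
    linarith

lemma exists_ncard_le_lowerDensity {Λ : Set ℝ} (hΛ : Separated Λ) {ε : ℝ} (hε : 0 < ε) (M : ℝ) :
    ∃ L ≥ M, ∃ a : ℝ, ((Λ ∩ Set.Icc a (a + L)).ncard : ℝ) ≤ (lowerDensity Λ + ε) * L := by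
  obtain ⟨δ, hδ, h⟩ := hΛ
  have hbdd : IsBoundedUnder (· ≤ ·) atTop
      (fun r : ℝ => ⨅ x : ℝ, ((Λ ∩ Set.Icc x (x + r)).ncard : ℝ) / r) := by
    refine ⟨1 / δ + 1, eventually_map.2 ?_⟩
    filter_upwards [eventually_ge_atTop 1] with r hr
    refine (ciInf_le (bddBelow_range_ncard_div Λ (by linarith)) 0).trans ?_
    have hle := (Separated.finite_ncard_inter_Icc_le hδ h 0 (0 + r) (by linarith)).2
    rw [div_le_iff₀ (by linarith)]
    calc ((Λ ∩ Set.Icc 0 (0 + r)).ncard : ℝ) ≤ (0 + r - 0) / δ + 1 := hle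
      _ = 1 / δ * r + 1 := by ring
      _ ≤ (1 / δ + 1) * r := by linarith
  have hlt : lowerDensity Λ < lowerDensity Λ + ε := by linarith
  have hfreq := frequently_lt_of_liminf_lt hbdd.isCoboundedUnder_ge hlt
  obtain ⟨L, hL, hinf⟩ := frequently_atTop.1 hfreq (max M 1)
  obtain ⟨a, ha⟩ := exists_lt_of_ciInf_lt hinf
  have hpos : 0 < L := by linarith [le_max_right M 1]
  rw [div_lt_iff₀ hpos] at ha
  exact ⟨L, (le_max_left _ _).trans hL, a, ha.le⟩

/-- The integers at distance at most `s` from `x`. -/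
def intsNear (x s : ℝ) : Finset ℤ := Finset.Icc ⌈x - s⌉ ⌊x + s⌋

lemma mem_intsNear {x s : ℝ} {n : ℤ} : n ∈ intsNear x s ↔ |(n : ℝ) - x| ≤ s := by
  rw [intsNear, Finset.mem_Icc, Int.ceil_le, Int.le_floor, abs_le]
  constructor <;> rintro ⟨h₁, h₂⟩ <;> constructor <;> linarith

lemma card_intsNear_bounds (x : ℝ) {s : ℝ} (hs : 0 ≤ s) :
    2 * s - 1 ≤ ((intsNear x s).card : ℝ) ∧ ((intsNear x s).card : ℝ) ≤ 2 * s + 1 := by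
  have h₁ := Int.ceil_lt_add_one (x - s)
  have h₂ := Int.le_ceil (x - s)
  have h₃ := Int.lt_floor_add_one (x + s)
  have h₄ := Int.floor_le (x + s)
  have hnn : 0 ≤ ⌊x + s⌋ + 1 - ⌈x - s⌉ := by
    have : ((⌈x - s⌉ - ⌊x + s⌋ : ℤ) : ℝ) < ((2 : ℤ) : ℝ) := by push_cast; linarith
    have := Int.cast_lt.1 this
    omega
  have hcast : ((intsNear x s).card : ℝ) = ⌊x + s⌋ + 1 - ⌈x - s⌉ := by
    rw [intsNear, Int.card_Icc]
    exact_mod_cast Int.toNat_of_nonneg hnn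
  rw [hcast]
  constructor <;> linarith

/-- Half the length of the chord cut out by the line of abscissa `n` in a disc of radius `r`
centred at abscissa `x`. -/
def halfChord (x r : ℝ) (n : ℤ) : ℝ := √(r ^ 2 - (n - x) ^ 2)

lemma halfChord_nonneg (x r : ℝ) (n : ℤ) : 0 ≤ halfChord x r n := Real.sqrt_nonneg _

lemma halfChord_le (x : ℝ) {r : ℝ} (hr : 0 ≤ r) (n : ℤ) : halfChord x r n ≤ r :=
  Real.sqrt_le_iff.2 ⟨hr, by nlinarith [sq_nonneg ((n : ℝ) - x)]⟩

lemma abs_le_sqrt_sub_sq_iff {r u v : ℝ} (hu : |u| ≤ r) :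
    |v| ≤ √(r ^ 2 - u ^ 2) ↔ u ^ 2 + v ^ 2 ≤ r ^ 2 := by
  have h0 : 0 ≤ r ^ 2 - u ^ 2 := sub_nonneg.2 (sq_le_sq' (abs_le.1 hu).1 (abs_le.1 hu).2)
  rw [Real.le_sqrt (abs_nonneg v) h0, sq_abs, le_sub_iff_add_le']

lemma integral_sqrt_sq_sub_sq {r : ℝ} (hr : 0 < r) :
    ∫ t in Set.Icc (-r) r, √(r ^ 2 - t ^ 2) = Real.pi * r ^ 2 / 2 := by
  have h := intervalIntegral.integral_comp_mul_right (a := -1) (b := 1)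
    (fun t => √(r ^ 2 - t ^ 2)) hr.ne'
  have hs : ∀ u : ℝ, √(r ^ 2 - (u * r) ^ 2) = r * √(1 - u ^ 2) := fun u => by
    rw [show r ^ 2 - (u * r) ^ 2 = r ^ 2 * (1 - u ^ 2) by ring, Real.sqrt_mul (sq_nonneg r),
      Real.sqrt_sq hr.le]
  simp only [hs, intervalIntegral.integral_const_mul, integral_sqrt_one_sub_sq, smul_eq_mul,
    neg_mul, one_mul] at h
  rw [integral_Icc_eq_integral_Ioc, ← intervalIntegral.integral_of_le (by linarith)]
  field_simp at h ⊢
  linarith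

lemma integrable_indicator_Icc_one (a b : ℝ) :
    Integrable ((Set.Icc a b).indicator (1 : ℝ → ℝ)) volume :=
  (integrable_indicator_iff measurableSet_Icc).2 (by simp [Pi.one_def])

/-- The sum of the chord lengths, computed by counting horizontally. -/
lemma sum_two_mul_halfChord_bounds (x : ℝ) {r : ℝ} (hr : 0 < r) :
    Real.pi * r ^ 2 - 2 * r ≤ ∑ n ∈ intsNear x r, 2 * halfChord x r n ∧
      ∑ n ∈ intsNear x r, 2 * halfChord x r n ≤ Real.pi * r ^ 2 + 2 * r := by
  set f : ℝ → ℝ := fun t =>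
    ∑ n ∈ intsNear x r, (Set.Icc (-halfChord x r n) (halfChord x r n)).indicator 1 t with hf
  have hfint : IntegrableOn f (Set.Icc (-r) r) volume :=
    (integrable_finsetSum _ fun n _ => integrable_indicator_Icc_one _ _).integrableOn
  have hval : ∫ t in Set.Icc (-r) r, f t = ∑ n ∈ intsNear x r, 2 * halfChord x r n := by
    rw [integral_finsetSum _ fun n _ => (integrable_indicator_Icc_one _ _).integrableOn]
    refine Finset.sum_congr rfl fun n _ => ?_
    have h0 := halfChord_nonneg x r n
    have h1 := halfChord_le x hr.le n
    rw [setIntegral_indicator measurableSet_Icc, Set.inter_eq_right.2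
      (Set.Icc_subset_Icc (by linarith) h1)]
    simp only [Pi.one_apply, setIntegral_const, smul_eq_mul, mul_one]
    rw [Real.volume_real_Icc_of_le (by linarith)]
    ring
  have hcount : ∀ t ∈ Set.Icc (-r) r, f t = ((intsNear x √(r ^ 2 - t ^ 2)).card : ℝ) := by
    intro t ht
    have ht' : |t| ≤ r := abs_le.2 ht
    have hfilter : intsNear x √(r ^ 2 - t ^ 2)
        = (intsNear x r).filter fun n => t ∈ Set.Icc (-halfChord x r n) (halfChord x r n) := by
      ext n
      rw [Finset.mem_filter, mem_intsNear, mem_intsNear, Set.mem_Icc, ← abs_le, halfChord,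
        abs_le_sqrt_sub_sq_iff ht']
      constructor
      · intro h
        have hn : |(n : ℝ) - x| ≤ r := abs_le_of_sq_le_sq (by nlinarith [sq_nonneg t]) hr.le
        exact ⟨hn, (abs_le_sqrt_sub_sq_iff hn).2 (by linarith)⟩
      · rintro ⟨hn, h⟩
        linarith [(abs_le_sqrt_sub_sq_iff hn).1 h]
    rw [hfilter, Finset.card_filter]
    push_cast
    exact Finset.sum_congr rfl fun n _ => by simp [Set.indicator_apply]
  have hsqrt : IntegrableOn (fun t : ℝ => √(r ^ 2 - t ^ 2)) (Set.Icc (-r) r) volume :=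
    Continuous.integrableOn_Icc (by fun_prop)
  have hone : IntegrableOn (fun _ : ℝ => (1 : ℝ)) (Set.Icc (-r) r) volume := by simp
  have hconst : ∫ _ in Set.Icc (-r) r, (1 : ℝ) = 2 * r := by
    simp only [setIntegral_const, smul_eq_mul, mul_one]
    rw [Real.volume_real_Icc_of_le (by linarith)]
    ring
  rw [← hval]
  constructor
  · calc Real.pi * r ^ 2 - 2 * r = ∫ t in Set.Icc (-r) r, (2 * √(r ^ 2 - t ^ 2) - 1) := by
          rw [integral_sub (hsqrt.const_mul 2) hone, integral_const_mul,
            integral_sqrt_sq_sub_sq hr, hconst]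
          ring
      _ ≤ _ := setIntegral_mono_on ((hsqrt.const_mul 2).sub hone) hfint measurableSet_Icc
          fun t ht => by
            rw [hcount t ht]; exact (card_intsNear_bounds x (Real.sqrt_nonneg _)).1
  · calc _ ≤ ∫ t in Set.Icc (-r) r, (2 * √(r ^ 2 - t ^ 2) + 1) :=
          setIntegral_mono_on hfint ((hsqrt.const_mul 2).add hone) measurableSet_Icc
          fun t ht => by
            rw [hcount t ht]; exact (card_intsNear_bounds x (Real.sqrt_nonneg _)).2
      _ = Real.pi * r ^ 2 + 2 * r := by
          rw [integral_add (hsqrt.const_mul 2) hone, integral_const_mul,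
            integral_sqrt_sq_sub_sq hr, hconst]
          ring

/-- The sheared product `{(n, λ − σn/π) : n ∈ ℤ, λ ∈ Λ}` in the complex plane. -/
def shearedSet (Λ : Set ℝ) (σ : ℝ) : Set ℂ :=
  {w : ℂ | ∃ n : ℤ, ∃ l ∈ Λ,
    w = ((n : ℝ) : ℂ) + ((l - σ * n / Real.pi : ℝ) : ℂ) * Complex.I}

lemma ncard_shearedSet_inter_closedBall {Λ : Set ℝ} (hΛ : Separated Λ) (σ : ℝ) (z : ℂ) {r : ℝ}
    (hr : 0 ≤ r) :
    (shearedSet Λ σ ∩ Metric.closedBall z r).ncard = ∑ n ∈ intsNear z.re r,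
      (Λ ∩ Set.Icc (z.im + σ * n / Real.pi - halfChord z.re r n)
        (z.im + σ * n / Real.pi + halfChord z.re r n)).ncard := by
  set F : ℤ → Finset ℝ := fun n => (hΛ.finite_inter_Icc
    (z.im + σ * n / Real.pi - halfChord z.re r n)
    (z.im + σ * n / Real.pi + halfChord z.re r n)).toFinset with hF
  set φ : (Σ _ : ℤ, ℝ) → ℂ := fun p =>
    ((p.1 : ℝ) : ℂ) + ((p.2 - σ * p.1 / Real.pi : ℝ) : ℂ) * Complex.I with hφ
  have hre : ∀ p, (φ p).re = p.1 := fun p => by simp [hφ]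
  have him : ∀ p, (φ p).im = p.2 - σ * p.1 / Real.pi := fun p => by simp [hφ]
  have hinj : Function.Injective φ := by
    rintro ⟨n, l⟩ ⟨m, k⟩ h
    have h₁ := congrArg Complex.re h
    rw [hre, hre] at h₁
    obtain rfl : n = m := by exact_mod_cast h₁
    have h₂ := congrArg Complex.im h
    rw [him, him] at h₂
    obtain rfl : l = k := by simpa using h₂
    rfl
  have hmem : ∀ n l, φ ⟨n, l⟩ ∈ Metric.closedBall z r ↔ n ∈ intsNear z.re r ∧
      l ∈ Set.Icc (z.im + σ * n / Real.pi - halfChord z.re r n)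
        (z.im + σ * n / Real.pi + halfChord z.re r n) := by
    intro n l
    have hIcc : l ∈ Set.Icc (z.im + σ * n / Real.pi - halfChord z.re r n)
        (z.im + σ * n / Real.pi + halfChord z.re r n) ↔
        |l - σ * n / Real.pi - z.im| ≤ halfChord z.re r n := by
      rw [abs_le, Set.mem_Icc]
      constructor <;> rintro ⟨h₁, h₂⟩ <;> constructor <;> linarith
    rw [Metric.mem_closedBall, Complex.dist_eq_re_im, Real.sqrt_le_left hr, hre, him, hIcc,
      mem_intsNear, halfChord]
    constructor
    · intro h
      have hn : |(n : ℝ) - z.re| ≤ r :=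
        abs_le_of_sq_le_sq (by nlinarith [sq_nonneg (l - σ * n / Real.pi - z.im)]) hr
      exact ⟨hn, (abs_le_sqrt_sub_sq_iff hn).2 h⟩
    · rintro ⟨hn, h⟩
      exact (abs_le_sqrt_sub_sq_iff hn).1 h
  have hset : shearedSet Λ σ ∩ Metric.closedBall z r
      = φ '' ((intsNear z.re r).sigma F : Finset (Σ _ : ℤ, ℝ)) := by
    ext w
    simp only [Set.mem_inter_iff, Set.mem_image, Finset.mem_coe, Finset.mem_sigma, hF,
      Set.Finite.mem_toFinset]
    constructor
    · rintro ⟨⟨n, l, hl, rfl⟩, hw⟩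
      have := (hmem n l).1 hw
      exact ⟨⟨n, l⟩, ⟨this.1, hl, this.2⟩, rfl⟩
    · rintro ⟨⟨n, l⟩, ⟨hn, hl, hI⟩, rfl⟩
      exact ⟨⟨n, l, hl, rfl⟩, (hmem n l).2 ⟨hn, hI⟩⟩
  rw [hset, Set.ncard_image_of_injective _ hinj, Set.ncard_coe_finset, Finset.card_sigma]
  exact Finset.sum_congr rfl fun n _ => (Set.ncard_eq_toFinset_card _ _).symm

lemma le_ncard_shearedSet_inter_closedBall {Λ : Set ℝ} (hΛ : Separated Λ) (σ : ℝ) {d C : ℝ}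
    (hC : 0 ≤ C)
    (h : ∀ a b : ℝ, a ≤ b → d * (b - a) - C ≤ ((Λ ∩ Set.Icc a b).ncard : ℝ)) (z : ℂ) {r : ℝ}
    (hr : 0 < r) :
    d * (Real.pi * r ^ 2) - (|d| * (2 * r) + C * (2 * r + 1))
      ≤ ((shearedSet Λ σ ∩ Metric.closedBall z r).ncard : ℝ) := by
  obtain ⟨h₁, h₂⟩ := sum_two_mul_halfChord_bounds z.re hr
  have habs : |∑ n ∈ intsNear z.re r, 2 * halfChord z.re r n - Real.pi * r ^ 2| ≤ 2 * r :=
    abs_le.2 ⟨by linarith, by linarith⟩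
  have hd : |d * (∑ n ∈ intsNear z.re r, 2 * halfChord z.re r n - Real.pi * r ^ 2)|
      ≤ |d| * (2 * r) := by
    rw [abs_mul]; gcongr
  have hcard : C * ((intsNear z.re r).card : ℝ) ≤ C * (2 * r + 1) := by
    gcongr; exact (card_intsNear_bounds z.re hr.le).2
  have hsum : d * (∑ n ∈ intsNear z.re r, 2 * halfChord z.re r n)
      - C * ((intsNear z.re r).card : ℝ)
      ≤ ((shearedSet Λ σ ∩ Metric.closedBall z r).ncard : ℝ) := by
    rw [ncard_shearedSet_inter_closedBall hΛ σ z hr.le]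
    push_cast
    calc d * (∑ n ∈ intsNear z.re r, 2 * halfChord z.re r n) - C * ((intsNear z.re r).card : ℝ)
        = ∑ n ∈ intsNear z.re r, (d * (2 * halfChord z.re r n) - C) := by
          rw [Finset.sum_sub_distrib, Finset.mul_sum, Finset.sum_const, nsmul_eq_mul]
          ring
      _ ≤ _ := Finset.sum_le_sum fun n _ => by
          refine le_trans (le_of_eq ?_) (h _ _ ?_)
          · ring
          · linarith [halfChord_nonneg z.re r n]
  have := (abs_le.1 hd).1
  rw [mul_sub] at this
  linarith

lemma ncard_inter_Icc_eq_sum_indicator {Λ : Set ℝ} {a b : ℝ} (hfin : (Λ ∩ Set.Icc a b).Finite)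
    {y c h : ℝ} (ha : a ≤ y + c - h) (hb : y + c + h ≤ b) :
    ((Λ ∩ Set.Icc (y + c - h) (y + c + h)).ncard : ℝ)
      = ∑ l ∈ hfin.toFinset, (Set.Icc (l - c - h) (l - c + h)).indicator (1 : ℝ → ℝ) y := by
  classical
  have hset : Λ ∩ Set.Icc (y + c - h) (y + c + h)
      = (hfin.toFinset.filter fun l => y ∈ Set.Icc (l - c - h) (l - c + h) : Finset ℝ) := by
    ext l
    simp only [Finset.coe_filter, Set.Finite.mem_toFinset, Set.mem_inter_iff, Set.mem_Icc,
      Set.mem_ofPred_eq]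
    constructor
    · rintro ⟨hl, h₁, h₂⟩
      exact ⟨⟨hl, by linarith, by linarith⟩, by linarith, by linarith⟩
    · rintro ⟨⟨hl, -⟩, h₁, h₂⟩
      exact ⟨hl, by linarith, by linarith⟩
  rw [hset, Set.ncard_coe_finset, Finset.card_filter]
  push_cast
  exact Finset.sum_congr rfl fun n _ => by simp [Set.indicator_apply]

/-- Averaging the number of points of the sheared set over discs with centre on the imaginary
axis. -/
lemma mul_le_ncard_mul_of_le_ncard_shearedSet {Λ : Set ℝ} (hΛ : Separated Λ) (σ : ℝ) {r K : ℝ}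
    (hr : 0 < r)
    (hK : ∀ z : ℂ, K ≤ ((shearedSet Λ σ ∩ Metric.closedBall z r).ncard : ℝ)) (a : ℝ) {L : ℝ}
    (hL : 2 * (|σ| * r / Real.pi + r) ≤ L) :
    K * (L - 2 * (|σ| * r / Real.pi + r))
      ≤ ((Λ ∩ Set.Icc a (a + L)).ncard : ℝ) * (Real.pi * r ^ 2 + 2 * r) := by
  set A := |σ| * r / Real.pi + r with hA
  have hfin := hΛ.finite_inter_Icc a (a + L)
  set c : ℤ → ℝ := fun n => σ * n / Real.pi with hc
  set H : ℤ → ℝ := halfChord 0 r with hH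
  set f : ℝ → ℝ := fun y => ∑ n ∈ intsNear 0 r, ∑ l ∈ hfin.toFinset,
    (Set.Icc (l - c n - H n) (l - c n + H n)).indicator (1 : ℝ → ℝ) y with hf
  have hfint : Integrable f volume :=
    integrable_finsetSum _ fun n _ => integrable_finsetSum _ fun l _ =>
      integrable_indicator_Icc_one _ _
  have hf0 : 0 ≤ f := fun y => Finset.sum_nonneg fun n _ => Finset.sum_nonneg fun l _ =>
    Set.indicator_nonneg (fun _ _ => zero_le_one) _
  have hKf : ∀ y ∈ Set.Icc (a + A) (a + L - A), K ≤ f y := by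
    intro y hy
    refine (hK ⟨0, y⟩).trans (le_of_eq ?_)
    rw [ncard_shearedSet_inter_closedBall hΛ σ _ hr.le]
    push_cast
    refine Finset.sum_congr rfl fun n hn => ?_
    have hn' : |(n : ℝ)| ≤ r := by simpa using mem_intsNear.1 hn
    have hcn : |c n| ≤ |σ| * r / Real.pi := by
      rw [hc]; simp only [abs_div, abs_mul, abs_of_pos Real.pi_pos]; gcongr
    have hHn : H n ≤ r := halfChord_le 0 hr.le n
    have := abs_le.1 hcn
    exact ncard_inter_Icc_eq_sum_indicator hfin (by linarith [hy.1]) (by linarith [hy.2])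
  calc K * (L - 2 * A) = ∫ _ in Set.Icc (a + A) (a + L - A), K := by
        rw [setIntegral_const, Real.volume_real_Icc_of_le (by linarith), smul_eq_mul]
        ring
    _ ≤ ∫ y in Set.Icc (a + A) (a + L - A), f y :=
        setIntegral_mono_on (by simp) hfint.integrableOn measurableSet_Icc hKf
    _ ≤ ∫ y, f y := setIntegral_le_integral hfint (Eventually.of_forall hf0)
    _ = ∑ n ∈ intsNear 0 r, ∑ l ∈ hfin.toFinset, 2 * H n := by
        rw [integral_finsetSum _ fun n _ => integrable_finsetSum _ fun l _ =>
          integrable_indicator_Icc_one _ _]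
        refine Finset.sum_congr rfl fun n _ => ?_
        rw [integral_finsetSum _ fun l _ => integrable_indicator_Icc_one _ _]
        refine Finset.sum_congr rfl fun l _ => ?_
        rw [integral_indicator_one measurableSet_Icc, Real.volume_real_Icc_of_le
          (by linarith [halfChord_nonneg 0 r n])]
        ring
    _ = ((Λ ∩ Set.Icc a (a + L)).ncard : ℝ) * ∑ n ∈ intsNear 0 r, 2 * H n := by
        simp only [Finset.sum_const, nsmul_eq_mul, Finset.mul_sum,
          Set.ncard_eq_toFinset_card _ hfin]
    _ ≤ _ := by
        gcongr
        exact (sum_two_mul_halfChord_bounds 0 hr).2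

lemma le_lowerDensity_mul_of_le_ncard_shearedSet {Λ : Set ℝ} (hΛ : Separated Λ) (σ : ℝ) {r K : ℝ}
    (hr : 0 < r)
    (hK : ∀ z : ℂ, K ≤ ((shearedSet Λ σ ∩ Metric.closedBall z r).ncard : ℝ)) :
    K ≤ lowerDensity Λ * (Real.pi * r ^ 2 + 2 * r) := by
  set P := Real.pi * r ^ 2 + 2 * r with hP
  set A := |σ| * r / Real.pi + r with hA
  have hPpos : 0 < P := by have := Real.pi_pos; positivity
  rw [← div_le_iff₀ hPpos]
  refine le_of_forall_pos_lt_add fun ε hε => ?_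
  rw [div_lt_iff₀ hPpos]
  by_contra! hcon
  set G := K - (lowerDensity Λ + ε / 2) * P with hG
  have hGpos : 0 < G := by nlinarith [mul_pos hε hPpos]
  obtain ⟨L, hL, a, ha⟩ :=
    exists_ncard_le_lowerDensity hΛ (half_pos hε) (max (2 * A) ((2 * A * K + 1) / G))
  have h₁ := mul_le_ncard_mul_of_le_ncard_shearedSet hΛ σ hr hK a ((le_max_left _ _).trans hL)
  have h₂ := (div_le_iff₀ hGpos).1 ((le_max_right _ _).trans hL)
  have h₃ := mul_le_mul_of_nonneg_right ha hPpos.le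
  rw [hG] at h₂
  nlinarith

lemma tendsto_iInf_ncard_shearedSet {Λ : Set ℝ} (hΛ : Separated Λ) (σ : ℝ) :
    Tendsto (fun r : ℝ => ⨅ z : ℂ,
      ((shearedSet Λ σ ∩ Metric.closedBall z r).ncard : ℝ) / (Real.pi * r ^ 2)) atTop
      (nhds (lowerDensity Λ)) := by
  have hpi := Real.pi_pos
  have hinv : Tendsto (fun r : ℝ => r⁻¹) atTop (nhds 0) := tendsto_inv_atTop_zero
  refine tendsto_order.2 ⟨fun b hb => ?_, fun b hb => ?_⟩
  · have hε : 0 < (lowerDensity Λ - b) / 2 := by linarith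
    obtain ⟨C, hC, h⟩ := lowerDensity_le_ncard Λ hε
    set d := lowerDensity Λ - (lowerDensity Λ - b) / 2 with hd
    have hbd : b < d := by rw [hd]; linarith
    have hlim : Tendsto (fun r : ℝ =>
        d - (|d| * 2 * r⁻¹ + C * (2 * r⁻¹ + r⁻¹ * r⁻¹)) / Real.pi) atTop (nhds d) := by
      have := ((hinv.const_mul (|d| * 2)).add
        (((hinv.const_mul 2).add (hinv.mul hinv)).const_mul C)).div_const Real.pi
      simpa using this.const_sub d
    filter_upwards [hlim.eventually (lt_mem_nhds hbd), eventually_gt_atTop 0] with r hbr hr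
    refine hbr.trans_le (le_ciInf fun z => ?_)
    rw [le_div_iff₀ (by positivity)]
    refine le_trans (le_of_eq ?_) (le_ncard_shearedSet_inter_closedBall hΛ σ hC h z hr)
    field_simp
  · have hlim : Tendsto (fun r : ℝ => lowerDensity Λ * (1 + 2 / Real.pi * r⁻¹)) atTop
        (nhds (lowerDensity Λ)) := by
      simpa using ((hinv.const_mul (2 / Real.pi)).const_add 1).const_mul (lowerDensity Λ)
    filter_upwards [hlim.eventually (gt_mem_nhds hb), eventually_gt_atTop 0] with r hbr hr
    refine lt_of_le_of_lt ?_ hbr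
    have hpos : 0 < Real.pi * r ^ 2 := by positivity
    have hbdd : BddBelow (Set.range fun z : ℂ =>
        ((shearedSet Λ σ ∩ Metric.closedBall z r).ncard : ℝ) / (Real.pi * r ^ 2)) :=
      ⟨0, by rintro _ ⟨z, rfl⟩; positivity⟩
    have hle := le_lowerDensity_mul_of_le_ncard_shearedSet hΛ σ hr
      (fun z => (le_div_iff₀ hpos).1 (ciInf_le hbdd z))
    rw [← le_div_iff₀ hpos] at hle
    refine hle.trans (le_of_eq ?_)
    field_simp

/-- for separated `Λ ⊆ ℝ` and the sheared set
`S = {(n, λ − σn/π) : n ∈ ℤ, λ ∈ Λ} ⊆ ℝ² ≅ ℂ`, the lower planar Beurling density of `S`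
equals the lower linear Beurling density of `Λ`. -/
theorem statement17 (Λ : Set ℝ) (hΛ : Separated Λ) (σ : ℝ) :
    liminf (fun r : ℝ => ⨅ z : ℂ,
        ((({w : ℂ | ∃ n : ℤ, ∃ l ∈ Λ, w = ((n : ℝ) : ℂ) + ((l - σ * n / Real.pi : ℝ) : ℂ) * Complex.I} ∩
            Metric.closedBall z r).ncard : ℝ) / (Real.pi * r ^ 2))) atTop
      = lowerDensity Λ := by
  exact (tendsto_iInf_ncard_shearedSet hΛ σ).liminf_eq

end
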